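/- arXiv:1706.09231 — 2 statements merged into one kernel-verified Lean document; each statement's English description precedes it below -/
import Mathlib

section
/- (Deterministic part of Theorem 1.) Consider the linear model Y = Xβ⁰ + ε with X an n×p real matrix, β⁰, β̂ ∈ ℝ^p, ε ∈ ℝⁿ, and λ_J > 0. Fix J ⊆ {1,…,p} and B̂ ∈ ℝ^{|J^c|×|J|}; set X̃ := X_J − X_{J^c}B̂, Σ̂_J := X̃ᵀX̃/n (assumed positive definite, with positive-definite inverse square root Σ̂_J^{−1/2}), T_J := X̃ᵀX_J/n (assumed invertible), M := √n·Σ̂_J^{−1/2}T_J, and b̂_J := β̂_J + T_J^{−1}X̃ᵀ(Y − Xβ̂)/n ∈ ℝ^{|J|}. Let g be a norm on ℝ^p and define Ψ(A) := Σ_{j∈J} g(A_j) for |J^c|×|J| matrices A (columns extended by zero to ℝ^p on the coordinates J), with dual matrix norm Ψ*. Assume the dual feasibility condition Ψ*( X_{J^c}ᵀ X̃ Σ̂_J^{−1/2}/n ) ≤ λ_J. Then M(b̂_J − β⁰_J) = Σ̂_J^{−1/2}X̃ᵀε/√n + rem, where rem := Σ̂_J^{−1/2}X̃ᵀX_{J^c}(β⁰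 − β̂)_{J^c}/√n satisfies ‖rem‖_∞ ≤ √n·λ_J·g((β̂ − β⁰)_{J^c}). -/
open Finset Matrix

/-- A norm on `ℝ^p`: positive definite, absolutely homogeneous and subadditive. -/
def IsNorm {p : ℕ} (N : (Fin p → ℝ) → ℝ) : Prop :=
  (∀ β, N β = 0 → β = 0) ∧ (∀ (c : ℝ) (β), N (c • β) = |c| * N β) ∧
    (∀ β γ, N (β + γ) ≤ N β + N γ)

theorem IsNorm.map_zero {p : ℕ} {g : (Fin p → ℝ) → ℝ} (hg : IsNorm g) : g 0 = 0 := by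
  simpa using hg.2.1 0 0

theorem IsNorm.map_neg {p : ℕ} {g : (Fin p → ℝ) → ℝ} (hg : IsNorm g) (β : Fin p → ℝ) :
    g (-β) = g β := by
  simpa using hg.2.1 (-1) β

theorem IsNorm.nonneg {p : ℕ} {g : (Fin p → ℝ) → ℝ} (hg : IsNorm g) (β : Fin p → ℝ) :
    0 ≤ g β := by
  have h := hg.2.2 β (-β)
  rw [add_neg_cancel, hg.map_zero, hg.map_neg] at h
  linarith

/-- A linear functional on a finite-dimensional space is bounded with respect to any norm. -/
theorem LinearMap.exists_abs_le_mul_of_norm {E : Type*} [AddCommGroup E] [Module ℝ E]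
    [FiniteDimensional ℝ E] (g : E → ℝ) (h0 : ∀ x, 0 ≤ g x) (hdef : ∀ x, g x = 0 → x = 0)
    (hsmul : ∀ (c : ℝ) (x), g (c • x) = |c| * g x) (hadd : ∀ x y, g (x + y) ≤ g x + g y)
    (f : E →ₗ[ℝ] ℝ) : ∃ C, ∀ x, |f x| ≤ C * g x := by
  let : Norm E := ⟨g⟩
  have core : NormedSpace.Core ℝ E :=
    { norm_nonneg := h0
      norm_smul := hsmul
      norm_triangle := hadd
      norm_eq_zero_iff := fun x =>
        ⟨hdef x, fun hx => by
          have h := hsmul 0 x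
          rw [hx, smul_zero, abs_zero, zero_mul] at h
          rw [hx]
          exact h⟩ }
  let : NormedAddCommGroup E := NormedAddCommGroup.ofCore core
  let : NormedSpace ℝ E := NormedSpace.ofCore core
  exact ⟨‖LinearMap.toContinuousLinearMap f‖,
    fun x => (LinearMap.toContinuousLinearMap f).le_opNorm x⟩

theorem IsNorm.exists_abs_apply_le {p : ℕ} {g : (Fin p → ℝ) → ℝ} (hg : IsNorm g) (i : Fin p) :
    ∃ C, ∀ β, |β i| ≤ C * g β :=
  LinearMap.exists_abs_le_mul_of_norm g hg.nonneg hg.1 hg.2.1 hg.2.2 (LinearMap.proj i)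

/-- The unit ball of `Ψ(A) = ∑ j, g (A_j)` has bounded image under `A ↦ tr(Aᵀ Z)`. -/
theorem IsNorm.bddAbove_pairing {p : ℕ} {g : (Fin p → ℝ) → ℝ} (hg : IsNorm g)
    {S : Finset (Fin p)} {κ : Type*} [Fintype κ] (Z : Matrix {i // i ∈ S} κ ℝ) :
    BddAbove ((fun A : Matrix {i // i ∈ S} κ ℝ => ∑ j, ∑ i, A i j * Z i j) ''
      {A | (∑ j, g (fun i : Fin p => if h : i ∈ S then A ⟨i, h⟩ j else 0)) ≤ 1}) := by
  choose C hC using hg.exists_abs_apply_le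
  refine ⟨∑ j, ∑ i : {i // i ∈ S}, |C i| * |Z i j|, ?_⟩
  rintro _ ⟨A, hA, rfl⟩
  refine Finset.sum_le_sum fun j _ => Finset.sum_le_sum fun i _ => ?_
  have hj : g (fun i : Fin p => if h : i ∈ S then A ⟨i, h⟩ j else 0) ≤ 1 :=
    (Finset.single_le_sum
      (f := fun j => g (fun i : Fin p => if h : i ∈ S then A ⟨i, h⟩ j else 0))
      (fun k _ => hg.nonneg _) (Finset.mem_univ j)).trans hA
  have hi := hC i (fun i : Fin p => if h : i ∈ S then A ⟨i, h⟩ j else 0)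
  simp only [i.2, dif_pos, Subtype.coe_eta] at hi
  have hAi : |A i j| ≤ |C i| := by
    refine hi.trans ((mul_le_mul_of_nonneg_right (le_abs_self _) (hg.nonneg _)).trans ?_)
    exact mul_le_of_le_one_right (abs_nonneg _) hj
  calc A i j * Z i j ≤ |A i j| * |Z i j| := (le_abs_self _).trans (abs_mul _ _).le
    _ ≤ |C i| * |Z i j| := mul_le_mul_of_nonneg_right hAi (abs_nonneg _)

/-- Column-wise dual norm inequality for `Ψ(A) = ∑ j, g (A_j)`. -/
theorem IsNorm.sum_mul_le_of_dual_le {p : ℕ} {g : (Fin p → ℝ) → ℝ} (hg : IsNorm g)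
    {S : Finset (Fin p)} {κ : Type*} [Fintype κ] (Z : Matrix {i // i ∈ S} κ ℝ) {l : ℝ}
    (hZ : sSup ((fun A : Matrix {i // i ∈ S} κ ℝ => ∑ j, ∑ i, A i j * Z i j) ''
      {A | (∑ j, g (fun i : Fin p => if h : i ∈ S then A ⟨i, h⟩ j else 0)) ≤ 1}) ≤ l)
    (v : Fin p → ℝ) (j : κ) :
    ∑ i : {i // i ∈ S}, v i * Z i j ≤ l * g (fun i => if i ∈ S then v i else 0) := by
  classical
  set w : Fin p → ℝ := fun i => if i ∈ S then v i else 0 with hw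
  have hwv (i : {i // i ∈ S}) : w i = v i := by simp [hw]
  rcases (hg.nonneg w).eq_or_lt' with h0 | hpos
  · have hv (i : {i // i ∈ S}) : v i = 0 := by rw [← hwv, hg.1 w h0]; rfl
    simp [hv, h0]
  · let A : Matrix {i // i ∈ S} κ ℝ := fun i k => if k = j then (g w)⁻¹ * v i else 0
    have hcol (k : κ) : (fun i : Fin p => if h : i ∈ S then A ⟨i, h⟩ k else 0) =
        if k = j then (g w)⁻¹ • w else 0 := by
      funext i
      by_cases hk : k = j <;> by_cases hi : i ∈ S <;> simp [A, hk, hi, hw]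
    have hgk (k : κ) : g (if k = j then (g w)⁻¹ • w else 0) = if k = j then 1 else 0 := by
      split_ifs
      · rw [hg.2.1, abs_of_pos (inv_pos.2 hpos), inv_mul_cancel₀ hpos.ne']
      · exact hg.map_zero
    have hA : (∑ k, g (fun i : Fin p => if h : i ∈ S then A ⟨i, h⟩ k else 0)) ≤ 1 := by
      simp only [hcol, hgk]
      simp
    have hle := (le_csSup (hg.bddAbove_pairing Z) ⟨A, hA, rfl⟩).trans hZ
    have hval : ∑ k, ∑ i, A i k * Z i k = (g w)⁻¹ * ∑ i : {i // i ∈ S}, v i * Z i j := by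
      rw [Finset.sum_eq_single j (fun k _ hk => by simp [A, hk]) (by simp), Finset.mul_sum]
      simp [A, mul_assoc]
    simp only [hval] at hle
    rwa [inv_mul_le_iff₀ hpos, mul_comm] at hle

/-- Splitting a matrix-vector product along a set of columns and its complement. -/
theorem mulVec_eq_add_compl {n p : ℕ} (X : Matrix (Fin n) (Fin p) ℝ) (J : Finset (Fin p))
    (v : Fin p → ℝ) :
    X.mulVec v = (Matrix.of fun i (j : {j // j ∈ J}) => X i j).mulVec (fun j => v j) +
      (Matrix.of fun i (j : {j // j ∈ Jᶜ}) => X i j).mulVec (fun j => v j) := by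
  funext i
  simp only [Matrix.mulVec, dotProduct, Pi.add_apply, Matrix.of_apply]
  rw [← Finset.sum_add_sum_compl J, ← Finset.sum_coe_sort J, ← Finset.sum_coe_sort Jᶜ]

/-- Deterministic part of Theorem 1: decomposition of the normalized `|J|`-de-sparsified
`Ω`-structured estimator and the `ℓ∞` bound on the remainder term. -/
theorem stmt7 {n p : ℕ} (hn : 0 < n)
    (X : Matrix (Fin n) (Fin p) ℝ) (Y ε : Fin n → ℝ) (β0 βh : Fin p → ℝ)
    (hmodel : Y = X.mulVec β0 + ε)
    (J : Finset (Fin p)) (lamJ : ℝ) (hlam : 0 < lamJ)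
    (g : (Fin p → ℝ) → ℝ) (hg : IsNorm g)
    (Bh : Matrix {i // i ∈ Jᶜ} {j // j ∈ J} ℝ)
    -- the submatrices `X_J`, `X_{Jᶜ}` and `X̃ = X_J − X_{Jᶜ}B̂`
    (XJ : Matrix (Fin n) {j // j ∈ J} ℝ) (hXJ : XJ = fun i j => X i j.val)
    (XJc : Matrix (Fin n) {i // i ∈ Jᶜ} ℝ) (hXJc : XJc = fun i j => X i j.val)
    (Xt : Matrix (Fin n) {j // j ∈ J} ℝ) (hXt : Xt = XJ - XJc * Bh)
    -- `Σ̂_J = X̃ᵀX̃/n`, positive definite with positive definite inverse square root `R`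
    (Sh : Matrix {j // j ∈ J} {j // j ∈ J} ℝ) (hSh : Sh = ((n : ℝ))⁻¹ • (Xtᵀ * Xt))
    (hShpd : Sh.PosDef)
    (R : Matrix {j // j ∈ J} {j // j ∈ J} ℝ) (hRpd : R.PosDef) (hRsq : R * Sh * R = 1)
    -- `T_J = X̃ᵀX_J/n`, assumed invertible, and `M = √n · Σ̂_J^{−1/2} T_J`
    (TJ : Matrix {j // j ∈ J} {j // j ∈ J} ℝ) (hT : TJ = ((n : ℝ))⁻¹ • (Xtᵀ * XJ))
    (hTinv : IsUnit TJ.det)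
    (M : Matrix {j // j ∈ J} {j // j ∈ J} ℝ) (hM : M = Real.sqrt n • (R * TJ))
    -- the `|J|`-de-sparsified estimator `b̂_J`
    (bh : {j // j ∈ J} → ℝ)
    (hb : bh = (fun j => βh j.val) +
      ((n : ℝ))⁻¹ • (TJ⁻¹ * Xtᵀ).mulVec (Y - X.mulVec βh))
    -- the dual matrix norm `Ψ*` of `Ψ(A) = Σ_{j∈J} g(A_j)` (columns extended by zero)
    (Ψd : Matrix {i // i ∈ Jᶜ} {j // j ∈ J} ℝ → ℝ)
    (hΨd : Ψd = fun Z => sSup ((fun A => ∑ j, ∑ i, A i j * Z i j) ''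
      {A : Matrix {i // i ∈ Jᶜ} {j // j ∈ J} ℝ |
        (∑ j : {j // j ∈ J},
          g (fun i : Fin p => if h : i ∈ Jᶜ then A ⟨i, h⟩ j else 0)) ≤ 1}))
    -- dual feasibility condition
    (hfeas : Ψd (((n : ℝ))⁻¹ • (XJcᵀ * Xt * R)) ≤ lamJ)
    -- the remainder term
    (rem : {j // j ∈ J} → ℝ)
    (hrem : rem = (Real.sqrt n)⁻¹ •
      (R * Xtᵀ * XJc).mulVec (fun i : {i // i ∈ Jᶜ} => β0 i.val - βh i.val)) :
    M.mulVec (fun j => bh j - β0 j.val) =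
        (Real.sqrt n)⁻¹ • (R * Xtᵀ).mulVec ε + rem ∧
      ∀ j, |rem j| ≤ Real.sqrt n * lamJ *
        g (fun i : Fin p => if i ∈ Jᶜ then βh i - β0 i else 0) := by
  have hs : Real.sqrt n * (n : ℝ)⁻¹ = (Real.sqrt n)⁻¹ := by
    rw [← div_eq_mul_inv, Real.sqrt_div_self', one_div]
  constructor
  · have hres : Y - X.mulVec βh = XJ.mulVec (fun j => β0 j.val - βh j.val) +
        XJc.mulVec (fun i => β0 i.val - βh i.val) + ε := by
      have h := mulVec_eq_add_compl X J (β0 - βh)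
      rw [Matrix.mulVec_sub] at h
      rw [hmodel, add_sub_right_comm, h, hXJ, hXJc]
      rfl
    have hdiff : (fun j => bh j - β0 j.val) =
        -(fun j : {j // j ∈ J} => β0 j.val - βh j.val) +
          ((n : ℝ))⁻¹ • (TJ⁻¹ * Xtᵀ).mulVec (Y - X.mulVec βh) := by
      funext j
      simp only [hb, Pi.add_apply, Pi.neg_apply]
      ring
    have hcancel : R * TJ * (TJ⁻¹ * Xtᵀ) = R * Xtᵀ := by
      rw [Matrix.mul_assoc, Matrix.mul_nonsing_inv_cancel_left _ _ hTinv]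
    have hRT : R * TJ = ((n : ℝ))⁻¹ • (R * Xtᵀ * XJ) := by
      rw [hT, Matrix.mul_smul, Matrix.mul_assoc]
    rw [hdiff, hM, hrem, Matrix.smul_mulVec, Matrix.mulVec_add, Matrix.mulVec_smul,
      Matrix.mulVec_mulVec, hcancel, hres, hRT, Matrix.smul_mulVec, Matrix.mulVec_neg,
      Matrix.mulVec_add, Matrix.mulVec_add, Matrix.mulVec_mulVec, Matrix.mulVec_mulVec, ← hs]
    module
  · intro j
    have hRt : Rᵀ = R := by simpa using hRpd.isHermitian.eq
    set Z := ((n : ℝ))⁻¹ • (XJcᵀ * Xt * R) with hZ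
    have hZt : ((n : ℝ))⁻¹ • (R * Xtᵀ * XJc) = Zᵀ := by
      rw [hZ, Matrix.transpose_smul, Matrix.transpose_mul, Matrix.transpose_mul, hRt,
        Matrix.transpose_transpose, Matrix.mul_assoc]
    have hremj : rem j = Real.sqrt n * -∑ i : {i // i ∈ Jᶜ}, (βh i - β0 i) * Z i j := by
      rw [hrem, ← hs, mul_smul, ← Matrix.smul_mulVec, hZt, ← Finset.sum_neg_distrib]
      simp only [Pi.smul_apply, smul_eq_mul, Matrix.mulVec, dotProduct, Matrix.transpose_apply]
      congr 1
      exact Finset.sum_congr rfl fun i _ => by ring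
    rw [hΨd] at hfeas
    have h1 := hg.sum_mul_le_of_dual_le Z hfeas (βh - β0) j
    have h2 := hg.sum_mul_le_of_dual_le Z hfeas (-(βh - β0)) j
    have hneg : (fun i : Fin p => if i ∈ Jᶜ then (-(βh - β0)) i else 0) =
        -(fun i : Fin p => if i ∈ Jᶜ then (βh - β0) i else 0) := by
      funext i
      by_cases hi : i ∈ Jᶜ <;> simp only [hi, if_true, if_false, Pi.neg_apply, neg_zero]
    rw [hneg, hg.map_neg] at h2
    simp only [Pi.neg_apply, neg_mul, Finset.sum_neg_distrib, Pi.sub_apply] at h1 h2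
    rw [hremj, abs_mul, abs_of_nonneg (Real.sqrt_nonneg _), abs_neg, mul_assoc]
    exact mul_le_mul_of_nonneg_left (abs_le.2 ⟨by linarith, h1⟩) (Real.sqrt_nonneg _)
end

section
/- Let G₁,…,G_g be a partition of {1,…,p} into nonempty groups. For β ∈ ℝ^p define β^𝒢 ∈ ℝ^g by (β^𝒢)_i := √|G_i| · ‖β_{G_i}‖₂, where ‖β_{G_i}‖₂ is the Euclidean norm of the restriction of β to G_i. Then the group wedge functional ‖β‖_{GWedge} := ‖β^𝒢‖_W, where ‖·‖_W is the wedge norm on ℝ^g, is a norm on ℝ^p. -/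
open Finset

/-- The wedge norm on `ℝ^k`:
`‖v‖_W = inf { (1/2)·Σ_j (v_j²/a_j + a_j) : a₁ ≥ a₂ ≥ … ≥ a_k > 0 }`. -/
noncomputable def wedge (k : ℕ) (v : Fin k → ℝ) : ℝ :=
  sInf ((fun a : Fin k → ℝ => (1 / 2) * ∑ j, (v j ^ 2 / a j + a j)) ''
    {a | (∀ j, 0 < a j) ∧ ∀ j j' : Fin k, j ≤ j' → a j' ≤ a j})

theorem wedge_le {k : ℕ} {v a : Fin k → ℝ} (ha : ∀ j, 0 < a j)
    (hanti : ∀ j j' : Fin k, j ≤ j' → a j' ≤ a j) :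
    wedge k v ≤ (1 / 2) * ∑ j, (v j ^ 2 / a j + a j) := by
  refine csInf_le ⟨0, ?_⟩ ⟨a, ⟨ha, hanti⟩, rfl⟩
  rintro _ ⟨b, ⟨hb, -⟩, rfl⟩
  have : ∀ j, 0 ≤ v j ^ 2 / b j + b j := fun j => by
    have := hb j
    positivity
  have := Finset.sum_nonneg fun j (_ : j ∈ Finset.univ) => this j
  dsimp only
  positivity

theorem le_wedge {k : ℕ} {v : Fin k → ℝ} {r : ℝ}
    (h : ∀ a : Fin k → ℝ, (∀ j, 0 < a j) → (∀ j j' : Fin k, j ≤ j' → a j' ≤ a j) →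
      r ≤ (1 / 2) * ∑ j, (v j ^ 2 / a j + a j)) :
    r ≤ wedge k v := by
  refine le_csInf ⟨_, fun _ => 1, ⟨fun _ => one_pos, fun _ _ _ => le_rfl⟩, rfl⟩ ?_
  rintro _ ⟨a, ⟨ha, hanti⟩, rfl⟩
  exact h a ha hanti

theorem abs_le_wedge {k : ℕ} (v : Fin k → ℝ) (i : Fin k) : |v i| ≤ wedge k v := by
  refine le_wedge fun a ha _ => ?_
  have hi : v i ^ 2 / a i + a i ≤ ∑ j, (v j ^ 2 / a j + a j) := by
    refine Finset.single_le_sum (f := fun j => v j ^ 2 / a j + a j) (fun j _ => ?_)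
      (Finset.mem_univ i)
    have := ha j
    positivity
  have hamgm : 2 * |v i| ≤ v i ^ 2 / a i + a i := by
    have hpos := ha i
    have heq : v i ^ 2 / a i + a i - 2 * |v i| = (|v i| - a i) ^ 2 / a i := by
      rw [← sq_abs (v i)]
      field_simp
      ring
    have : 0 ≤ (|v i| - a i) ^ 2 / a i := by positivity
    linarith
  linarith

theorem wedge_mono {k : ℕ} {v w : Fin k → ℝ} (h : ∀ j, |v j| ≤ |w j|) :
    wedge k v ≤ wedge k w := by
  refine le_wedge fun a ha hanti => (wedge_le ha hanti).trans ?_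
  gcongr ?_ * ∑ j, (?_ + _) with j
  exact div_le_div_of_nonneg_right (sq_le_sq.mpr (h j)) (ha j).le

theorem wedge_add_le {k : ℕ} (v w : Fin k → ℝ) :
    wedge k (v + w) ≤ wedge k v + wedge k w := by
  rw [← sub_le_iff_le_add]
  refine le_wedge fun a ha hanti => ?_
  rw [sub_le_iff_le_add', ← sub_le_iff_le_add]
  refine le_wedge fun b hb hbanti => ?_
  rw [sub_le_iff_le_add]
  refine (wedge_le (a := a + b) (fun j => add_pos (ha j) (hb j))
    fun j j' h => add_le_add (hanti j j' h) (hbanti j j' h)).trans ?_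
  rw [← mul_add, ← Finset.sum_add_distrib]
  gcongr ?_ * ∑ j, ?_ with j
  have haj := ha j
  have hbj := hb j
  have hsq : v j ^ 2 / a j + w j ^ 2 / b j - (v j + w j) ^ 2 / (a j + b j) =
      (b j * v j - a j * w j) ^ 2 / (a j * b j * (a j + b j)) := by
    field_simp
    ring
  have : 0 ≤ (b j * v j - a j * w j) ^ 2 / (a j * b j * (a j + b j)) := by positivity
  simp only [Pi.add_apply]
  linarith

theorem wedge_smul_le {k : ℕ} {c : ℝ} (hc : c ≠ 0) (v : Fin k → ℝ) :
    wedge k (c • v) ≤ |c| * wedge k v := by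
  have hc' : 0 < |c| := abs_pos.mpr hc
  rw [← div_le_iff₀' hc']
  refine le_wedge fun a ha hanti => ?_
  rw [div_le_iff₀' hc']
  refine (wedge_le (a := fun j => |c| * a j) (fun j => mul_pos hc' (ha j))
    fun j j' h => mul_le_mul_of_nonneg_left (hanti j j' h) hc'.le).trans_eq ?_
  rw [mul_left_comm |c|, Finset.mul_sum Finset.univ _ |c|]
  congr 1
  refine Finset.sum_congr rfl fun j _ => ?_
  have := ha j
  simp only [Pi.smul_apply, smul_eq_mul, mul_pow]
  rw [← sq_abs c]
  field_simp

theorem wedge_smul {k : ℕ} (c : ℝ) (v : Fin k → ℝ) :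
    wedge k (c • v) = |c| * wedge k v := by
  have key : ∀ {c : ℝ}, c ≠ 0 → ∀ v : Fin k → ℝ, wedge k (c • v) = |c| * wedge k v := by
    intro c hc v
    refine (wedge_smul_le hc v).antisymm ?_
    have h := wedge_smul_le (inv_ne_zero hc) (c • v)
    rwa [inv_smul_smul₀ hc, abs_inv, ← div_eq_inv_mul, le_div_iff₀' (abs_pos.mpr hc)] at h
  rcases eq_or_ne c 0 with rfl | hc
  · have h := key (two_ne_zero : (2 : ℝ) ≠ 0) (0 : Fin k → ℝ)
    rw [smul_zero, abs_two] at h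
    rw [zero_smul, abs_zero, zero_mul]
    linarith
  · exact key hc v

theorem sqrt_sum_add_sq_le {ι : Type*} (s : Finset ι) (f h : ι → ℝ) :
    √(∑ j ∈ s, (f j + h j) ^ 2) ≤ √(∑ j ∈ s, f j ^ 2) + √(∑ j ∈ s, h j ^ 2) := by
  refine Real.sqrt_le_iff.mpr ⟨by positivity, ?_⟩
  have hcs := Real.sum_mul_le_sqrt_mul_sqrt s f h
  rw [add_sq, Real.sq_sqrt (Finset.sum_nonneg fun _ _ => sq_nonneg _),
    Real.sq_sqrt (Finset.sum_nonneg fun _ _ => sq_nonneg _)]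
  simp only [add_sq, Finset.sum_add_distrib, mul_assoc, ← Finset.mul_sum]
  linarith

/-- For a partition `G₁,…,G_g` of `{1,…,p}` into nonempty groups, the group wedge
functional `‖β‖_{GWedge} = ‖β^𝒢‖_W`, with `(β^𝒢)_i = √|G_i|·‖β_{G_i}‖₂`, is a norm. -/
theorem stmt14 {p g : ℕ} (G : Fin g → Finset (Fin p))
    (hdisj : ∀ i j, i ≠ j → Disjoint (G i) (G j))
    (hcover : Finset.univ.biUnion G = Finset.univ)
    (hne : ∀ i, (G i).Nonempty)
    (GW : (Fin p → ℝ) → ℝ)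
    (hGW : GW = fun β => wedge g
      (fun i => Real.sqrt ((G i).card) * Real.sqrt (∑ j ∈ G i, β j ^ 2))) :
    IsNorm GW := by
  subst hGW
  refine ⟨fun β h0 => ?_, fun c β => ?_, fun β γ => ?_⟩
  · funext j
    obtain ⟨i, -, hji⟩ := Finset.mem_biUnion.mp (hcover ▸ Finset.mem_univ j)
    have hi := (abs_le_wedge _ i).trans_eq h0
    have hcard : √((G i).card : ℝ) ≠ 0 :=
      (Real.sqrt_pos.mpr (Nat.cast_pos.mpr (hne i).card_pos)).ne'
    rw [abs_nonpos_iff, mul_eq_zero, or_iff_right hcard,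
      Real.sqrt_eq_zero (Finset.sum_nonneg fun _ _ => sq_nonneg _),
      Finset.sum_eq_zero_iff_of_nonneg fun _ _ => sq_nonneg _] at hi
    exact pow_eq_zero_iff two_ne_zero |>.mp (hi j hji)
  · dsimp only
    rw [← abs_abs c, ← wedge_smul]
    congr 1
    funext i
    simp only [Pi.smul_apply, smul_eq_mul, mul_pow, ← Finset.mul_sum]
    rw [Real.sqrt_mul (sq_nonneg c), Real.sqrt_sq_eq_abs, mul_left_comm]
  · refine le_trans (wedge_mono fun i => ?_) (wedge_add_le _ _)
    refine abs_le_abs_of_nonneg (by positivity) ?_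
    simp only [Pi.add_apply]
    rw [← mul_add]
    exact mul_le_mul_of_nonneg_left (sqrt_sum_add_sq_le _ _ _) (Real.sqrt_nonneg _)
end
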